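/- Assume hypotheses (V) and (K). Suppose there exists R₁ > 0 such that V(r) < +∞ for almost every r ∈ (0,R₁) and ess sup_{r∈(0,R₁)} K(r)/(r^{α₀} V(r)^{β₀}) < +∞ for some 0 ≤ β₀ ≤ 1 and α₀ > α*(β₀). Then lim_{R→0⁺} R₀(q₁,R) = 0 for every q₁ ∈ ℝ with max{1, 2β₀} < q₁ < q*(α₀,β₀). -/

import Mathlib

open MeasureTheory Filter Topology Set ENNReal

noncomputable section

/-- Euclidean space `ℝ^N`. -/
abbrev E (N : ℕ) := EuclideanSpace ℝ (Fin N)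

/-- The (classical) Laplacian of a function `φ : ℝ^N → ℝ`. -/
def lapl {N : ℕ} (φ : E N → ℝ) (x : E N) : ℝ :=
  ∑ i : Fin N, fderiv ℝ (fun y => fderiv ℝ φ y (EuclideanSpace.single i 1)) x
    (EuclideanSpace.single i 1)

/-- A function is radial if it depends only on the norm. -/
def IsRadial {N : ℕ} (u : E N → ℝ) : Prop := ∀ x y : E N, ‖x‖ = ‖y‖ → u x = u y

/-- The critical exponent `2** = 2N/(N-4)` as an element of `ℝ≥0∞`. -/
def twoSS (N : ℕ) : ℝ≥0∞ := (2 * N : ℝ≥0∞) / ((N : ℝ≥0∞) - 4)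

/-- `u ∈ D^{2,2}(ℝ^N)` with (distributional) Laplacian `w`: `u` lies in `L^{2**}`,
`w ∈ L²`, and `u` is the limit in `L^{2**}` of smooth compactly supported functions whose
Laplacians converge to `w` in `L²` (i.e. `u` lies in the closure of `C_c^∞` for the norm
`‖Δ·‖_{L²}`, with `Δu = w`). -/
def MemD22 (N : ℕ) (u w : E N → ℝ) : Prop :=
  MemLp u (twoSS N) volume ∧ MemLp w 2 volume ∧
  ∃ φ : ℕ → E N → ℝ,
    (∀ n, ContDiff ℝ (⊤ : ℕ∞) (φ n) ∧ HasCompactSupport (φ n)) ∧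
    Tendsto (fun n => eLpNorm (fun x => φ n x - u x) (twoSS N) volume) atTop (𝓝 0) ∧
    Tendsto (fun n => eLpNorm (fun x => lapl (φ n) x - w x) 2 volume) atTop (𝓝 0)

/-- `u ∈ H²_V(ℝ^N)` (with Laplacian `w`). -/
def MemH2V {N : ℕ} (V : ℝ → ℝ≥0∞) (u w : E N → ℝ) : Prop :=
  MemD22 N u w ∧ (∫⁻ x : E N, V ‖x‖ * ENNReal.ofReal ((u x) ^ 2)) < ⊤

/-- `u ∈ H²_{V,r}(ℝ^N)`: member of `H²_V` which is radial. -/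
def MemH2Vr {N : ℕ} (V : ℝ → ℝ≥0∞) (u w : E N → ℝ) : Prop :=
  MemH2V V u w ∧ IsRadial u

/-- The norm of `H²_V`: `‖u‖ = (∫ |Δu|² + V(|x|)u²)^{1/2}` (here `w = Δu`). -/
def H2norm {N : ℕ} (V : ℝ → ℝ≥0∞) (u w : E N → ℝ) : ℝ :=
  (((∫⁻ x : E N, ENNReal.ofReal ((w x) ^ 2)) +
    ∫⁻ x : E N, V ‖x‖ * ENNReal.ofReal ((u x) ^ 2)).toReal) ^ (1/2 : ℝ)

/-- Hypothesis (V): `V : (0,∞) → [0,∞]` measurable and locally integrable on `(0,∞)`. -/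
def HypV (V : ℝ → ℝ≥0∞) : Prop :=
  Measurable V ∧ ∀ a b : ℝ, 0 < a → (∫⁻ r in Set.Icc a b, V r) < ⊤

/-- Hypothesis (K): `K : (0,∞) → (0,∞)` measurable with `K ∈ L^s_loc((0,∞))`. -/
def HypK (K : ℝ → ℝ) (s : ℝ) : Prop :=
  (∀ r : ℝ, 0 < r → 0 < K r) ∧ Measurable K ∧ 1 < s ∧
  ∀ a b : ℝ, 0 < a → IntegrableOn (fun r => K r ^ s) (Set.Icc a b) volume

/-- The quantity `S₀(q,R)`. -/
def S0 (N : ℕ) (V : ℝ → ℝ≥0∞) (K : ℝ → ℝ) (q R : ℝ) : ℝ≥0∞ :=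
  ⨆ p : {p : (E N → ℝ) × (E N → ℝ) // MemH2Vr V p.1 p.2 ∧ H2norm V p.1 p.2 = 1},
    ∫⁻ x in Metric.ball (0 : E N) R, ENNReal.ofReal (K ‖x‖ * |p.1.1 x| ^ q)

/-- The quantity `S_∞(q,R)`. -/
def Sinf (N : ℕ) (V : ℝ → ℝ≥0∞) (K : ℝ → ℝ) (q R : ℝ) : ℝ≥0∞ :=
  ⨆ p : {p : (E N → ℝ) × (E N → ℝ) // MemH2Vr V p.1 p.2 ∧ H2norm V p.1 p.2 = 1},
    ∫⁻ x in (Metric.ball (0 : E N) R)ᶜ, ENNReal.ofReal (K ‖x‖ * |p.1.1 x| ^ q)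

/-- The quantity `R₀(q,R)`. -/
def R0 (N : ℕ) (V : ℝ → ℝ≥0∞) (K : ℝ → ℝ) (q R : ℝ) : ℝ≥0∞ :=
  ⨆ p : {p : ((E N → ℝ) × (E N → ℝ)) × ((E N → ℝ) × (E N → ℝ)) //
      MemH2Vr V p.1.1 p.1.2 ∧ MemH2Vr V p.2.1 p.2.2 ∧
      H2norm V p.1.1 p.1.2 = 1 ∧ H2norm V p.2.1 p.2.2 = 1},
    ∫⁻ x in Metric.ball (0 : E N) R,
      ENNReal.ofReal (K ‖x‖ * |p.1.1.1 x| ^ (q - 1) * |p.1.2.1 x|)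

/-- The quantity `R_∞(q,R)`. -/
def Rinf (N : ℕ) (V : ℝ → ℝ≥0∞) (K : ℝ → ℝ) (q R : ℝ) : ℝ≥0∞ :=
  ⨆ p : {p : ((E N → ℝ) × (E N → ℝ)) × ((E N → ℝ) × (E N → ℝ)) //
      MemH2Vr V p.1.1 p.1.2 ∧ MemH2Vr V p.2.1 p.2.2 ∧
      H2norm V p.1.1 p.1.2 = 1 ∧ H2norm V p.2.1 p.2.2 = 1},
    ∫⁻ x in (Metric.ball (0 : E N) R)ᶜ,
      ENNReal.ofReal (K ‖x‖ * |p.1.1.1 x| ^ (q - 1) * |p.1.2.1 x|)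

/-- The weighted measure `K(|x|)dx`. -/
def Kmeas (N : ℕ) (K : ℝ → ℝ) : Measure (E N) :=
  volume.withDensity (fun x => ENNReal.ofReal (K ‖x‖))

/-- Membership in the sum space `L^{q₁}_K + L^{q₂}_K`. -/
def MemSum (N : ℕ) (K : ℝ → ℝ) (q1 q2 : ℝ) (u : E N → ℝ) : Prop :=
  ∃ u1 u2 : E N → ℝ, u = u1 + u2 ∧ MemLp u1 (ENNReal.ofReal q1) (Kmeas N K) ∧
    MemLp u2 (ENNReal.ofReal q2) (Kmeas N K)

/-- The norm of the sum space `L^{q₁}_K + L^{q₂}_K`. -/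
def sumNorm (N : ℕ) (K : ℝ → ℝ) (q1 q2 : ℝ) (u : E N → ℝ) : ℝ≥0∞ :=
  ⨅ p : {p : (E N → ℝ) × (E N → ℝ) // u = p.1 + p.2},
    max (eLpNorm p.1.1 (ENNReal.ofReal q1) (Kmeas N K))
        (eLpNorm p.1.2 (ENNReal.ofReal q2) (Kmeas N K))

/-- `σ_N`, the (N-1)-dimensional measure of the unit sphere, i.e. `N·ω_N`. -/
def sigmaN (N : ℕ) : ℝ := N * (volume (Metric.ball (0 : E N) 1)).toReal

end

noncomputable section

/-- `α*(β) = max{4β-2-N/2, -(1-β)N}`. -/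
def alphaStar (N : ℕ) (β : ℝ) : ℝ := max (4*β - 2 - N/2) (-(1-β)*N)

/-- `q*(α,β) = 2(α-4β+N)/(N-4)`. -/
def qStar (N : ℕ) (α β : ℝ) : ℝ := 2 * (α - 4*β + N) / (N - 4)

def GG (m : ℕ) (g : ℝ → ℝ) (a t : ℝ) : ℝ := ∫ τ in a..t, g τ * τ ^ (m+1)
def pp (m : ℕ) (g : ℝ → ℝ) (a t : ℝ) : ℝ := GG m g a t / t ^ (m+2)
def FF (m : ℕ) (g : ℝ → ℝ) (a b t : ℝ) : ℝ :=
  -(1 / (m:ℝ)) * (GG m g a t / t ^ m + ∫ τ in t..b, g τ * τ)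

theorem GG_hasDerivAt (m : ℕ) {g : ℝ → ℝ} (hg : Continuous g) (a t : ℝ) :
    HasDerivAt (GG m g a) (g t * t ^ (m+1)) t := by
  have hc : Continuous fun τ : ℝ => g τ * τ ^ (m+1) := by fun_prop
  exact intervalIntegral.integral_hasDerivAt_right (hc.intervalIntegrable _ _)
    hc.stronglyMeasurable.stronglyMeasurableAtFilter hc.continuousAt

theorem GG_contDiff (m : ℕ) {g : ℝ → ℝ} (hg : Continuous g) (a : ℝ) :
    ContDiff ℝ 1 (GG m g a) := by
  rw [contDiff_one_iff_deriv]
  refine ⟨fun t => (GG_hasDerivAt m hg a t).differentiableAt, ?_⟩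
  have : deriv (GG m g a) = fun t => g t * t ^ (m+1) := by
    funext t; exact (GG_hasDerivAt m hg a t).deriv
  rw [this]; fun_prop

theorem GG_zero (m : ℕ) {g : ℝ → ℝ} {a t : ℝ} (h0 : ∀ t ≤ a, g t = 0) (ht : t ≤ a) :
    GG m g a t = 0 := by
  unfold GG
  rw [intervalIntegral.integral_congr (g := fun _ => (0:ℝ))]
  · simp
  · intro τ hτ
    rw [uIcc_of_ge ht] at hτ
    simp [h0 τ hτ.2]

theorem pp_hasDerivAt (m : ℕ) {g : ℝ → ℝ} (hg : Continuous g) (a : ℝ) {t : ℝ} (ht : 0 < t) :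
    HasDerivAt (pp m g a) (g t / t - (m+2) * pp m g a t / t) t := by
  have h := (GG_hasDerivAt m hg a t).div (hasDerivAt_pow (m+2) t) (by positivity)
  refine h.congr_deriv ?_
  unfold pp
  push_cast
  field_simp
  ring

theorem FF_hasDerivAt (m : ℕ) (hm : 1 ≤ m) {g : ℝ → ℝ} (hg : Continuous g) (a b : ℝ) {t : ℝ}
    (ht : 0 < t) : HasDerivAt (FF m g a b) (t * pp m g a t) t := by
  have hc : Continuous fun τ : ℝ => g τ * τ := by fun_prop
  have h1 := (GG_hasDerivAt m hg a t).div (hasDerivAt_pow m t) (by positivity)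
  have h2 : HasDerivAt (fun t => ∫ τ in t..b, g τ * τ) (-(g t * t)) t :=
    intervalIntegral.integral_hasDerivAt_left (hc.intervalIntegrable _ _)
      hc.stronglyMeasurable.stronglyMeasurableAtFilter hc.continuousAt
  refine ((h1.add h2).const_mul (-(1/(m:ℝ)))).congr_deriv ?_
  unfold pp
  obtain ⟨k, rfl⟩ : ∃ k, m = k + 1 := ⟨m - 1, by omega⟩
  simp only [Nat.add_sub_cancel]
  have : ((k+1 : ℕ) : ℝ) ≠ 0 := by positivity
  field_simp
  ring

theorem FF_const (m : ℕ) {g : ℝ → ℝ} (hg : Continuous g) {a b t : ℝ} (h0 : ∀ t ≤ a, g t = 0)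
    (ht : t ≤ a) : FF m g a b t = FF m g a b a := by
  have hc : Continuous fun τ : ℝ => g τ * τ := by fun_prop
  unfold FF
  rw [GG_zero m h0 ht, GG_zero m h0 le_rfl]
  have : (∫ τ in t..a, g τ * τ) = 0 := by
    rw [intervalIntegral.integral_congr (g := fun _ => (0:ℝ))]
    · simp
    · intro τ hτ
      rw [uIcc_of_le ht] at hτ
      simp [h0 τ hτ.2]
  rw [← intervalIntegral.integral_add_adjacent_intervals (hc.intervalIntegrable t a)
    (hc.intervalIntegrable a b), this]
  simp

theorem FF_bound1 (m : ℕ) (hm : 1 ≤ m) {g : ℝ → ℝ} (hg : Continuous g) {a b t : ℝ} (ha : 0 < a)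
    (hg0 : ∀ t, 0 ≤ g t) (hb : ∀ t, b ≤ t → g t = 0) (hat : a ≤ t) :
    |FF m g a b t| ≤ 1 / (m:ℝ) * (1 / t ^ m) * ∫ τ in a..b, g τ * τ ^ (m+1) := by
  have hc : Continuous fun τ : ℝ => g τ * τ := by fun_prop
  have hc2 : Continuous fun τ : ℝ => g τ * τ ^ (m+1) := by fun_prop
  have ht : 0 < t := ha.trans_le hat
  have hG : 0 ≤ GG m g a t := intervalIntegral.integral_nonneg hat fun τ hτ =>
    mul_nonneg (hg0 _) (pow_nonneg (ha.le.trans hτ.1) _)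
  have hHb : ∀ f : ℝ → ℝ, b ≤ t → ∫ τ in t..b, g τ * f τ = 0 := by
    intro f hbt
    rw [intervalIntegral.integral_congr (g := fun _ => (0:ℝ))]
    · simp
    · intro τ hτ
      rw [uIcc_of_ge hbt] at hτ
      simp [hb τ hτ.1]
  have hH : 0 ≤ ∫ τ in t..b, g τ * τ := by
    rcases le_total t b with h | h
    · exact intervalIntegral.integral_nonneg h fun τ hτ => mul_nonneg (hg0 _) (ht.le.trans hτ.1)
    · rw [hHb (fun τ => τ) h]
  have hH2 : (∫ τ in t..b, g τ * τ) ≤ 1 / t ^ m * ∫ τ in t..b, g τ * τ ^ (m+1) := by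
    rcases le_total t b with h | h
    · rw [← intervalIntegral.integral_const_mul]
      refine intervalIntegral.integral_mono_on h (hc.intervalIntegrable _ _)
        ((hc2.const_mul _).intervalIntegrable _ _) fun τ hτ => ?_
      have h1 : t ^ m ≤ τ ^ m := pow_le_pow_left₀ ht.le hτ.1 m
      have h2 : 0 ≤ g τ * τ := mul_nonneg (hg0 _) (ht.le.trans hτ.1)
      have h3 : 1 / t ^ m * (g τ * τ ^ (m+1)) = (g τ * τ) * (τ ^ m / t ^ m) := by
        field_simp; ring
      rw [h3]
      exact le_mul_of_one_le_right h2 ((one_le_div (by positivity)).2 h1)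
    · rw [hHb (fun τ => τ) h, hHb (fun τ => τ^(m+1)) h]; simp
  have hsum : (∫ τ in a..b, g τ * τ ^ (m+1)) = GG m g a t + ∫ τ in t..b, g τ * τ ^ (m+1) :=
    (intervalIntegral.integral_add_adjacent_intervals (hc2.intervalIntegrable a t)
    (hc2.intervalIntegrable t b)).symm
  have hm' : (0:ℝ) < m := by exact_mod_cast hm
  unfold FF
  rw [abs_mul, abs_neg, abs_of_pos (by positivity : 0 < 1 / (m:ℝ)),
    abs_of_nonneg (by positivity), hsum, mul_assoc]
  gcongr
  rw [mul_add]
  gcongr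
  apply le_of_eq; ring

theorem FF_bound (m : ℕ) (hm : 1 ≤ m) {g : ℝ → ℝ} (hg : Continuous g) {a b t : ℝ} (ha : 0 < a)
    (hab : a ≤ b) (ht : 0 ≤ t)
    (hg0 : ∀ t, 0 ≤ g t) (h0 : ∀ t ≤ a, g t = 0) (hb : ∀ t, b ≤ t → g t = 0) :
    |FF m g a b t| ≤ (∫ τ in a..b, g τ * τ ^ (m+1)) * (1 / m * (2 / a) ^ m) *
      (1 / (1 + t / a) ^ m) := by
  have hI : 0 ≤ ∫ τ in a..b, g τ * τ ^ (m+1) :=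
    intervalIntegral.integral_nonneg hab fun τ hτ =>
    mul_nonneg (hg0 _) (pow_nonneg (ha.le.trans hτ.1) _)
  have hm' : (0:ℝ) < m := by exact_mod_cast hm
  have key : ∀ t', a ≤ t' → t ≤ t' → |FF m g a b t'| ≤ (∫ τ in a..b, g τ * τ ^ (m+1)) *
      (1 / m * (2 / a) ^ m) * (1 / (1 + t / a) ^ m) := by
    intro t' h1 h2
    refine (FF_bound1 m hm hg ha hg0 hb h1).trans ?_
    have : 1 / t' ^ m ≤ (2/a)^m * (1 / (1+t/a)^m) := by
      have e : (2/a)^m * (1 / (1+t/a)^m) = 1 / ((a+t)/2)^m := by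
        rw [← one_div_pow, ← mul_pow, ← one_div_pow]
        congr 1
        field_simp
      rw [e]
      apply one_div_le_one_div_of_le (by positivity)
      apply pow_le_pow_left₀ (by positivity)
      linarith
    calc _ ≤ 1 / (m:ℝ) * ((2/a)^m * (1 / (1+t/a)^m)) * ∫ τ in a..b, g τ * τ ^ (m+1) := by gcongr
      _ = _ := by ring
  rcases le_total a t with h | h
  · exact key t h le_rfl
  · rw [FF_const m hg h0 h]; exact key a le_rfl h

theorem norm_fd {N : ℕ} {x : E N} (hx : x ≠ 0) :
    HasFDerivAt (fun y : E N => ‖y‖) (‖x‖⁻¹ • innerSL ℝ x) x := by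
  have h := (hasStrictFDerivAt_norm_sq x).hasFDerivAt.sqrt (by simpa using hx)
  have e : (fun y : E N => √(‖y‖ ^ 2)) = fun y => ‖y‖ := by
    funext y; exact Real.sqrt_sq (norm_nonneg y)
  rw [e] at h
  refine h.congr_fderiv ?_
  rw [Real.sqrt_sq (norm_nonneg x)]
  ext v
  simp
  field_simp

theorem near_zero {N : ℕ} {x : E N} {a : ℝ} (h : ‖x‖ < a) : ∀ᶠ y in 𝓝 x, ‖y‖ ≤ a :=
  (continuous_norm.continuousAt.eventually_lt_const h).mono fun _ h => h.le

theorem pp_fd {N : ℕ} (m : ℕ) {g : ℝ → ℝ} (hg : Continuous g) (a : ℝ) {x : E N} (hx : x ≠ 0) :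
    HasFDerivAt (fun y : E N => pp m g a ‖y‖)
      ((g ‖x‖ / ‖x‖ - (m+2) * pp m g a ‖x‖ / ‖x‖) • (‖x‖⁻¹ • innerSL ℝ x)) x :=
  (pp_hasDerivAt m hg a (norm_pos_iff.2 hx)).comp_hasFDerivAt x (norm_fd hx)

theorem pp_cd {N : ℕ} (m : ℕ) {g : ℝ → ℝ} (hg : Continuous g) {a : ℝ} (ha : 0 < a)
    (h0 : ∀ t ≤ a, g t = 0) : ContDiff ℝ 1 (fun y : E N => pp m g a ‖y‖) := by
  rw [contDiff_iff_contDiffAt]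
  intro x
  by_cases hx : x = 0
  · subst hx
    have : (fun y : E N => pp m g a ‖y‖) =ᶠ[𝓝 0] fun _ => 0 := by
      filter_upwards [near_zero (x := (0 : E N)) (by simpa using ha)] with y hy
      simp [pp, GG_zero m h0 hy]
    exact contDiffAt_const.congr_of_eventuallyEq this
  · have h1 : ContDiffAt ℝ 1 (fun y : E N => ‖y‖) x := contDiffAt_norm ℝ hx
    exact ((GG_contDiff m hg a).contDiffAt.comp x h1).div (h1.pow _)
      (pow_ne_zero _ (norm_ne_zero_iff.2 hx))

theorem FF_fd {N : ℕ} (m : ℕ) (hm : 1 ≤ m) {g : ℝ → ℝ} (hg : Continuous g) {a b : ℝ} (ha : 0 < a)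
    (h0 : ∀ t ≤ a, g t = 0) (x : E N) :
    HasFDerivAt (fun y : E N => FF m g a b ‖y‖) (pp m g a ‖x‖ • innerSL ℝ x) x := by
  by_cases hx : x = 0
  · subst hx
    have : (fun y : E N => FF m g a b ‖y‖) =ᶠ[𝓝 0] fun _ => FF m g a b a := by
      filter_upwards [near_zero (x := (0 : E N)) (by simpa using ha)] with y hy
      exact FF_const m hg h0 hy
    simpa using (hasFDerivAt_const (FF m g a b a) (0 : E N)).congr_of_eventuallyEq this
  · refine ((FF_hasDerivAt m hm hg a b (norm_pos_iff.2 hx)).comp_hasFDerivAt x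
      (norm_fd hx)).congr_fderiv ?_
    rw [smul_smul]
    congr 1
    have := norm_pos_iff.2 hx
    field_simp

theorem div_eq (m : ℕ) {g : ℝ → ℝ} (hg : Continuous g) {a : ℝ} (ha : 0 < a)
    (h0 : ∀ t ≤ a, g t = 0) (x : E (m+2)) :
    ∑ i : Fin (m+2), fderiv ℝ (fun y : E (m+2) => pp m g a ‖y‖ * y i) x
      (EuclideanSpace.single i 1) = g ‖x‖ := by
  by_cases hx : x = 0
  · subst hx
    have : ∀ i : Fin (m+2), (fun y : E (m+2) => pp m g a ‖y‖ * y i) =ᶠ[𝓝 0] fun _ => 0 := by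
      intro i
      filter_upwards [near_zero (x := (0 : E (m+2))) (by simpa using ha)] with y hy
      simp [pp, GG_zero m h0 hy]
    simp only [(this _).fderiv_eq]
    simp [h0 0 ha.le]
  · have hi : ∀ i : Fin (m+2), HasFDerivAt (fun y : E (m+2) => y i)
        (EuclideanSpace.proj i : E (m+2) →L[ℝ] ℝ) x := fun i =>
      (EuclideanSpace.proj i : E (m+2) →L[ℝ] ℝ).hasFDerivAt
    have hn := norm_pos_iff.2 hx
    have hs : ∑ i, x i * x i = ‖x‖ ^ 2 := by
      rw [EuclideanSpace.norm_sq_eq]; simp [pow_two]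
    calc _ = ∑ i : Fin (m+2), (pp m g a ‖x‖ + 
          (g ‖x‖ / ‖x‖ - (m+2) * pp m g a ‖x‖ / ‖x‖) * ‖x‖⁻¹ * (x i * x i)) := by
          refine Finset.sum_congr rfl fun i _ => ?_
          rw [HasFDerivAt.fderiv (f := fun y : E (m+2) => pp m g a ‖y‖ * y i)
            ((pp_fd m hg a hx).mul (hi i))]
          simp [EuclideanSpace.inner_single_right]
          ring
      _ = _ := by
          rw [Finset.sum_add_distrib, ← Finset.mul_sum, hs]
          simp
          field_simp
          ring

theorem cc_int {N : ℕ} {f g : E N → ℝ} (hf : Continuous f) (hfc : HasCompactSupport f)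
    (hg : Continuous g) : Integrable (fun x => f x * g x) :=
  (hf.mul hg).integrable_of_hasCompactSupport hfc.mul_right

theorem ibp (m : ℕ) (hm : 1 ≤ m) {g : ℝ → ℝ} (hg : Continuous g) {a b : ℝ} (ha : 0 < a)
    (h0 : ∀ t ≤ a, g t = 0) {φ : E (m+2) → ℝ} (hφ : ContDiff ℝ (⊤ : ℕ∞) φ)
    (hφc : HasCompactSupport φ) :
    ∫ x, φ x * g ‖x‖ = ∫ x, lapl φ x * FF m g a b ‖x‖ := by
  have hΨ := FF_fd (N := m+2) m hm hg (b := b) ha h0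
  have hΨc : Continuous fun y : E (m+2) => FF m g a b ‖y‖ :=
    continuous_iff_continuousAt.2 fun x => (hΨ x).continuousAt
  have hq := pp_cd (N := m+2) m hg ha h0
  have hqi : ∀ i : Fin (m+2), ContDiff ℝ 1 (fun y : E (m+2) => pp m g a ‖y‖ * y i) := fun i =>
    hq.mul (EuclideanSpace.proj i : E (m+2) →L[ℝ] ℝ).contDiff
  have hφ1 : ∀ v, ContDiff ℝ 1 (fun y => fderiv ℝ φ y v) := fun v =>
    (hφ.fderiv_right (m := 1) (by norm_cast)).clm_apply contDiff_const
  have hφd : Differentiable ℝ φ := hφ.differentiable (by simp)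
  have hφsupp : ∀ v, HasCompactSupport (fun y => fderiv ℝ φ y v) := fun v =>
    (hφc.fderiv_apply ℝ v)
  have hc1 : ∀ {f : E (m+2) → ℝ}, ContDiff ℝ 1 f → ∀ v, Continuous fun y => fderiv ℝ f y v :=
    fun hf v => (hf.continuous_fderiv (by simp)).clm_apply continuous_const
  have hΨi : ∀ x (i : Fin (m+2)), fderiv ℝ (fun y : E (m+2) => FF m g a b ‖y‖) x
      (EuclideanSpace.single i 1) = pp m g a ‖x‖ * x i := by
    intro x i
    rw [(hΨ x).fderiv]
    simp [EuclideanSpace.inner_single_right]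
  have key : ∀ i : Fin (m+2), ∫ x, φ x * fderiv ℝ (fun y : E (m+2) => pp m g a ‖y‖ * y i) x
      (EuclideanSpace.single i 1) = ∫ x, fderiv ℝ (fun y => fderiv ℝ φ y
        (EuclideanSpace.single i 1)) x (EuclideanSpace.single i 1) * FF m g a b ‖x‖ := by
    intro i
    set e : E (m+2) := EuclideanSpace.single i 1
    have hcφ := hc1 (hφ1 e) e
    have hccφ : HasCompactSupport fun x => fderiv ℝ (fun y => fderiv ℝ φ y e) x e :=
      (hφsupp e).fderiv_apply ℝ e
    rw [integral_mul_fderiv_eq_neg_fderiv_mul_of_integrable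
      (cc_int (hφ1 e).continuous (hφsupp e) (hqi i).continuous)
      (cc_int hφ.continuous hφc (hc1 (hqi i) e)) (cc_int hφ.continuous hφc (hqi i).continuous)
      (fun x _ => hφd x) (fun x _ => (hqi i).differentiable (by simp) x)]
    have h2 := integral_mul_fderiv_eq_neg_fderiv_mul_of_integrable (μ := (volume : Measure (E (m+2))))
      (f := fun y => fderiv ℝ φ y e) (g := fun y => FF m g a b ‖y‖) (v := e)
      (cc_int hcφ hccφ hΨc)
      (by simp only [e, hΨi]; exact cc_int (hφ1 e).continuous (hφsupp e) (hqi i).continuous)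
      (cc_int (hφ1 e).continuous (hφsupp e) hΨc)
      (fun x _ => (hφ1 e).differentiable (by simp) x) (fun x _ => (hΨ x).differentiableAt)
    simp only [e, hΨi] at h2 ⊢
    rw [h2, neg_neg]
  calc ∫ x, φ x * g ‖x‖ = ∫ x, ∑ i, φ x * fderiv ℝ (fun y : E (m+2) => pp m g a ‖y‖ * y i) x
        (EuclideanSpace.single i 1) := by
        congr 1; funext x; rw [← Finset.mul_sum, div_eq m hg ha h0]
    _ = ∑ i, ∫ x, φ x * fderiv ℝ (fun y : E (m+2) => pp m g a ‖y‖ * y i) x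
        (EuclideanSpace.single i 1) := integral_finsetSum _ fun i _ =>
        cc_int hφ.continuous hφc (hc1 (hqi i) _)
    _ = _ := by
        simp only [key, lapl, Finset.sum_mul]
        rw [integral_finsetSum]
        intro i _
        exact cc_int (hc1 (hφ1 _) _) ((hφsupp _).fderiv_apply ℝ _) hΨc

theorem ae_norm {N : ℕ} (hN : 1 ≤ N) {P : ℝ → Prop} (h : ∀ᵐ t : ℝ, 0 < t → P t) :
    ∀ᵐ x : E N, P ‖x‖ := by
  have : Nonempty (Fin N) := ⟨⟨0, hN⟩⟩
  obtain ⟨Z, hZs, hZm, hZ0⟩ := exists_measurable_superset_of_null (ae_iff.1 h)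
  have hz : ∀ᵐ y : ℝ, Z.indicator (fun _ => (1:ℝ)) y = 0 := by
    have : ∀ᵐ y : ℝ, y ∉ Z := measure_eq_zero_iff_ae_notMem.1 hZ0
    filter_upwards [this] with y hy
    simp [hy]
  have hz2 : (fun y : ℝ => y ^ (Module.finrank ℝ (E N) - 1) • Z.indicator (fun _ => (1:ℝ)) y)
      =ᵐ[volume.restrict (Ioi 0)] fun _ => (0:ℝ) := by
    filter_upwards [ae_restrict_of_ae hz] with y hy
    simp [hy]
  have hi : Integrable (fun x : E N => Z.indicator (fun _ => (1:ℝ)) ‖x‖) := by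
    rw [integrable_fun_norm_addHaar]
    exact (integrable_congr hz2).2 (integrable_zero _ _ _)
  have hintg : ∫ x : E N, Z.indicator (fun _ => (1:ℝ)) ‖x‖ = 0 := by
    rw [integral_fun_norm_addHaar, integral_congr_ae hz2]
    simp
  rw [integral_eq_zero_iff_of_nonneg (fun x => indicator_nonneg (fun _ _ => zero_le_one) _) hi]
    at hintg
  have h0 : ∀ᵐ x : E N, x ≠ 0 := by
    rw [ae_iff]; simp
  filter_upwards [hintg, h0] with x hx hx0
  by_contra hP
  have : ‖x‖ ∈ Z := hZs (by simp [hx0, hP])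
  simp [this] at hx

theorem one_le_twoSS {N : ℕ} (hN : 5 ≤ N) : 1 ≤ twoSS N := by
  unfold twoSS
  obtain ⟨k, rfl⟩ := Nat.exists_eq_add_of_le hN
  have : ((5 + k : ℕ) : ℝ≥0∞) - 4 = ((k + 1 : ℕ) : ℝ≥0∞) := by
    have h : ((5 + k : ℕ) : ℝ≥0∞) = ((k + 1 : ℕ) : ℝ≥0∞) + 4 := by push_cast; ring_nf
    rw [h]; exact ENNReal.add_sub_cancel_right (by simp)
  rw [this, ENNReal.le_div_iff_mul_le (by simp) (by simp), one_mul]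
  norm_cast; omega

theorem Bfin (m : ℕ) (hm : 3 ≤ m) :
    eLpNorm (fun x : E (m+2) => 1 / (1 + ‖x‖) ^ m) 2 volume < ⊤ := by
  have hc : Continuous (fun x : E (m+2) => 1 / (1 + ‖x‖) ^ m) := by
    refine continuous_const.div (by fun_prop) fun x => ?_
    positivity
  refine MemLp.eLpNorm_lt_top (p := 2) (μ := volume) ?_
  rw [memLp_two_iff_integrable_sq hc.aestronglyMeasurable]
  have h := integrable_one_add_norm (E := E (m+2)) (μ := volume) (r := 2 * m) (by
    simp; have : (3:ℝ) ≤ m := by exact_mod_cast hm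
    linarith)
  refine h.congr (Eventually.of_forall fun x => ?_)
  have h1 : (0:ℝ) < 1 + ‖x‖ := by positivity
  simp only
  rw [Real.rpow_neg h1.le, div_pow, one_pow, one_div, ← pow_mul]
  congr 1
  rw [mul_comm m 2]
  exact_mod_cast Real.rpow_natCast (1+‖x‖) (2*m)

theorem Bscale (m : ℕ) {a : ℝ} (ha : 0 < a) :
    eLpNorm (fun x : E (m+2) => 1 / (1 + ‖x‖ / a) ^ m) 2 volume =
      ENNReal.ofReal (a ^ (((m:ℝ)+2)/2)) *
        eLpNorm (fun x : E (m+2) => 1 / (1 + ‖x‖) ^ m) 2 volume := by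
  have hc : Continuous (fun x : E (m+2) => 1 / (1 + ‖x‖) ^ m) := by
    refine continuous_const.div (by fun_prop) fun x => ?_
    positivity
  have hmap := Measure.map_addHaar_smul (volume : Measure (E (m+2))) (inv_ne_zero ha.ne')
  have h1 : eLpNorm (fun x : E (m+2) => 1 / (1 + ‖x‖) ^ m) 2
      (Measure.map (fun x => a⁻¹ • x) (volume : Measure (E (m+2)))) =
      eLpNorm (fun x : E (m+2) => 1 / (1 + ‖x‖ / a) ^ m) 2 volume := by
    rw [eLpNorm_map_measure hc.aestronglyMeasurable (by fun_prop)]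
    congr 1
    funext x
    simp [norm_smul, abs_of_pos ha, div_eq_inv_mul]
  rw [← h1]
  erw [hmap]
  rw [eLpNorm_smul_measure_of_ne_top (by simp)]
  simp only [finrank_euclideanSpace, Fintype.card_fin, smul_eq_mul]
  congr 1
  rw [ENNReal.ofReal_rpow_of_nonneg (by positivity) (by simp)]
  congr 1
  rw [inv_pow, inv_inv, abs_of_pos (by positivity), ← Real.rpow_natCast, ← Real.rpow_mul ha.le]
  congr 1
  simp; ring

theorem cs_bound {N : ℕ} {f g : E N → ℝ} (hf : AEStronglyMeasurable f volume)
    (hg : AEStronglyMeasurable g volume) :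
    ‖∫ x, f x * g x‖ₑ ≤ eLpNorm f 2 volume * eLpNorm g 2 volume := by
  refine (enorm_integral_le_lintegral_enorm _).trans ?_
  rw [← eLpNorm_one_eq_lintegral_enorm]
  have h : eLpNorm (f • g) 1 volume ≤ eLpNorm f 2 volume * eLpNorm g 2 volume :=
    eLpNorm_smul_le_mul_eLpNorm hg hf
  exact h

theorem lim_int {N : ℕ} (hN : 5 ≤ N) {u : E N → ℝ} (hu : MemLp u (twoSS N) volume)
    {φ : ℕ → E N → ℝ} (hφ : ∀ n, ContDiff ℝ (⊤ : ℕ∞) (φ n) ∧ HasCompactSupport (φ n))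
    (hl : Tendsto (fun n => eLpNorm (fun x => φ n x - u x) (twoSS N) volume) atTop (𝓝 0))
    {g : ℝ → ℝ} (hg : Continuous g) {b : ℝ} (hb : ∀ t, b ≤ t → g t = 0) :
    Tendsto (fun n => ∫ x, φ n x * g ‖x‖) atTop (𝓝 (∫ x, u x * g ‖x‖)) := by
  have hgc : Continuous fun x : E N => g ‖x‖ := by fun_prop
  have hgs : HasCompactSupport fun x : E N => g ‖x‖ :=
    HasCompactSupport.of_support_subset_isCompact (isCompact_closedBall (0 : E N) b) (by
      intro x hx
      simp only [Metric.mem_closedBall, dist_zero_right]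
      by_contra h
      exact hx (hb _ (not_le.1 h).le))
  obtain ⟨M, hM⟩ := hgc.bounded_above_of_compact_support hgs
  have hM0 : 0 ≤ M := (norm_nonneg _).trans (hM 0)
  have hfinm : IsFiniteMeasure (volume.restrict (Metric.closedBall (0 : E N) b)) :=
    ⟨by simpa using measure_closedBall_lt_top⟩
  have huL : LocallyIntegrable u volume := hu.locallyIntegrable (one_le_twoSS hN)
  have hintg : ∀ f : E N → ℝ, LocallyIntegrable f volume → Integrable fun x => f x * g ‖x‖ := by
    intro f hf
    have := hf.integrable_smul_left_of_hasCompactSupport hgc hgs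
    simpa [mul_comm] using this
  refine tendsto_integral_of_L1 _ (hintg u huL).aestronglyMeasurable (Eventually.of_forall fun n =>
    hintg _ (hφ n).1.continuous.locallyIntegrable) ?_
  set D : ℝ≥0∞ := ENNReal.ofReal M * (volume.restrict (Metric.closedBall (0 : E N) b)) univ ^
    (1 / (1:ℝ≥0∞).toReal - 1 / (twoSS N).toReal)
  have hD : D ≠ ⊤ := by
    refine ENNReal.mul_ne_top ENNReal.ofReal_ne_top (ENNReal.rpow_ne_top_of_nonneg ?_
      (measure_ne_top _ _))
    have h1 : 1 ≤ (twoSS N).toReal ∨ (twoSS N).toReal = 0 := by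
      by_cases h : twoSS N = ⊤
      · right; simp [h]
      · left; simpa using ENNReal.toReal_mono h (one_le_twoSS hN)
    rcases h1 with h1 | h1
    · have : 1 / (twoSS N).toReal ≤ 1 := by
        rw [div_le_one (by linarith)]; exact h1
      simp at this ⊢; exact this
    · simp [h1]
  have hbound : ∀ n, ∫⁻ x, ‖φ n x * g ‖x‖ - u x * g ‖x‖‖ₑ ≤
      D * eLpNorm (fun x => φ n x - u x) (twoSS N) volume := by
    intro n
    have hm : AEStronglyMeasurable (fun x => φ n x - u x) volume :=
      (hφ n).1.continuous.aestronglyMeasurable.sub hu.1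
    calc ∫⁻ x, ‖φ n x * g ‖x‖ - u x * g ‖x‖‖ₑ 
        ≤ ∫⁻ x, (Metric.closedBall (0 : E N) b).indicator
          (fun x => ENNReal.ofReal M * ‖φ n x - u x‖ₑ) x := by
          refine lintegral_mono fun x => ?_
          by_cases hx : x ∈ Metric.closedBall (0 : E N) b
          · rw [indicator_of_mem hx, ← sub_mul, enorm_mul, mul_comm]
            gcongr
            rw [← ofReal_norm]
            exact ENNReal.ofReal_le_ofReal (hM x)
          · have : g ‖x‖ = 0 := hb _ (by simpa using (le_of_lt (by simpa using hx)))
            simp [this]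
      _ = ENNReal.ofReal M * eLpNorm (fun x => φ n x - u x) 1
            (volume.restrict (Metric.closedBall (0 : E N) b)) := by
          rw [lintegral_indicator measurableSet_closedBall, lintegral_const_mul' _ _ (by simp),
            eLpNorm_one_eq_lintegral_enorm]
      _ ≤ ENNReal.ofReal M * (eLpNorm (fun x => φ n x - u x) (twoSS N)
            (volume.restrict (Metric.closedBall (0 : E N) b)) *
            (volume.restrict (Metric.closedBall (0 : E N) b)) univ ^
            (1 / (1:ℝ≥0∞).toReal - 1 / (twoSS N).toReal)) := by
          gcongr
          exact eLpNorm_le_eLpNorm_mul_rpow_measure_univ (one_le_twoSS hN) hm.restrict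
      _ ≤ ENNReal.ofReal M * (eLpNorm (fun x => φ n x - u x) (twoSS N) volume *
            (volume.restrict (Metric.closedBall (0 : E N) b)) univ ^
            (1 / (1:ℝ≥0∞).toReal - 1 / (twoSS N).toReal)) := by
          gcongr
          exact Measure.restrict_le_self
      _ = _ := by simp only [D]; ring
  refine tendsto_of_tendsto_of_tendsto_of_le_of_le tendsto_const_nhds ?_ (fun _ => zero_le) hbound
  simpa using ENNReal.Tendsto.const_mul hl (Or.inr hD)

theorem lapl_cont {N : ℕ} {φ : E N → ℝ} (hφ : ContDiff ℝ (⊤ : ℕ∞) φ) : Continuous (lapl φ) := by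
  unfold lapl
  refine continuous_finsetSum _ fun i _ => ?_
  have hφ1 : ContDiff ℝ 1 (fun y => fderiv ℝ φ y (EuclideanSpace.single i 1)) :=
    (hφ.fderiv_right (m := 1) (by norm_cast)).clm_apply contDiff_const
  exact (hφ1.continuous_fderiv (by simp)).clm_apply continuous_const

theorem limit_bound (m : ℕ) (hm : 3 ≤ m) : ∃ C : ℝ, 0 ≤ C ∧ ∀ u w : E (m+2) → ℝ,
    MemD22 (m+2) u w → eLpNorm w 2 volume ≤ 1 → ∀ (g : ℝ → ℝ) (a b : ℝ), Continuous g →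
    (∀ t, 0 ≤ g t) → 0 < a → a ≤ b → (∀ t ≤ a, g t = 0) → (∀ t, b ≤ t → g t = 0) →
    |∫ x, u x * g ‖x‖| ≤ C * a ^ (-(((m:ℝ)-2)/2)) * ∫ τ in a..b, g τ * τ ^ (m+1) := by
  set B2 := eLpNorm (fun x : E (m+2) => 1 / (1 + ‖x‖) ^ m) 2 volume with hB2
  have hB : B2 < ⊤ := Bfin m hm
  refine ⟨1 / m * 2 ^ m * B2.toReal, by positivity, ?_⟩
  rintro u w ⟨hu, hw, φ, hφ, hl1, hl2⟩ hw1 g a b hg hg0 ha hab h0 hb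
  set I := ∫ τ in a..b, g τ * τ ^ (m+1)
  have hI : 0 ≤ I :=
    intervalIntegral.integral_nonneg hab fun τ hτ =>
    mul_nonneg (hg0 _) (pow_nonneg (ha.le.trans hτ.1) _)
  have hΨc : Continuous fun y : E (m+2) => FF m g a b ‖y‖ :=
    continuous_iff_continuousAt.2 fun x => (FF_fd m (by omega) hg ha h0 x).continuousAt
  set D : ℝ≥0∞ := ENNReal.ofReal (I * (1 / m * (2 / a) ^ m)) *
    (ENNReal.ofReal (a ^ (((m:ℝ)+2)/2)) * B2) with hD
  have hDtop : D ≠ ⊤ := by finiteness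
  have hΨ2 : eLpNorm (fun y : E (m+2) => FF m g a b ‖y‖) 2 volume ≤ D := by
    rw [hD, hB2, ← Bscale m ha]
    refine eLpNorm_le_mul_eLpNorm_of_ae_le_mul (Eventually.of_forall fun x => ?_) 2
    have := FF_bound m (by omega) hg ha hab (norm_nonneg x) hg0 h0 hb
    rw [Real.norm_eq_abs, Real.norm_eq_abs, abs_of_nonneg (a := 1 / (1 + ‖x‖ / a) ^ m)
      (by positivity)]
    exact this
  have hn : ∀ n, ‖∫ x, φ n x * g ‖x‖‖ₑ ≤
      (eLpNorm (fun x => lapl (φ n) x - w x) 2 volume + 1) * D := by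
    intro n
    have hlc := lapl_cont (hφ n).1
    rw [ibp m (by omega) hg (b := b) ha h0 (hφ n).1 (hφ n).2]
    refine (cs_bound hlc.aestronglyMeasurable hΨc.aestronglyMeasurable).trans ?_
    gcongr
    have h3 : lapl (φ n) = (fun x => lapl (φ n) x - w x) + w := by funext x; simp
    calc eLpNorm (lapl (φ n)) 2 volume
        = eLpNorm ((fun x => lapl (φ n) x - w x) + w) 2 volume := by rw [← h3]
      _ ≤ _ := (eLpNorm_add_le (hlc.aestronglyMeasurable.sub hw.1) hw.1 (by norm_num))
      _ ≤ _ := by gcongr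
  have hlim1 := (lim_int (by omega) hu hφ hl1 hg hb).enorm
  have hlim2 := ENNReal.Tendsto.mul_const (b := D) (hl2.add_const 1) (Or.inr hDtop)
  have := le_of_tendsto_of_tendsto' hlim1 hlim2 hn
  rw [zero_add, one_mul] at this
  have h4 := ENNReal.toReal_mono hDtop this
  rw [toReal_enorm, Real.norm_eq_abs] at h4
  refine h4.trans (le_of_eq ?_)
  rw [hD, ENNReal.toReal_mul, ENNReal.toReal_mul, ENNReal.toReal_ofReal (by positivity),
    ENNReal.toReal_ofReal (by positivity)]
  have h5 : a ^ (-(((m:ℝ)-2)/2)) = (a ^ m)⁻¹ * a ^ (((m:ℝ)+2)/2) := by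
    rw [← Real.rpow_natCast, ← Real.rpow_neg ha.le, ← Real.rpow_add ha]
    congr 1; ring
  rw [h5, div_pow]
  field_simp

theorem pointwise (m : ℕ) (hm : 3 ≤ m) : ∃ C : ℝ, 0 ≤ C ∧ ∀ u w : E (m+2) → ℝ,
    MemD22 (m+2) u w → IsRadial u → eLpNorm w 2 volume ≤ 1 →
    ∀ᵐ x : E (m+2), |u x| ≤ C * ‖x‖ ^ (-(((m:ℝ)-2)/2)) := by
  obtain ⟨C, hC, hbd⟩ := limit_bound m hm
  set ω : ℝ := (m+2) * volume.real (Metric.ball (0 : E (m+2)) 1) with hω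
  have hωpos : 0 < ω := by
    have : 0 < volume.real (Metric.ball (0 : E (m+2)) 1) := by
      rw [measureReal_def, ENNReal.toReal_pos_iff]
      exact ⟨Metric.measure_ball_pos _ _ one_pos, measure_ball_lt_top⟩
    positivity
  refine ⟨C / ω, by positivity, fun u w hD hr hw => ?_⟩
  set e : E (m+2) := EuclideanSpace.single 0 1 with he
  have hen : ‖e‖ = 1 := by simp [he]
  set U : ℝ → ℝ := fun t => u (t • e) with hU
  have huU : ∀ x, u x = U ‖x‖ := fun x => hr _ _ (by simp [norm_smul, hen])
  have huL : LocallyIntegrable u volume := hD.1.locallyIntegrable (one_le_twoSS (by omega))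
  set f : ℝ → ℝ := (Ioi (0:ℝ)).indicator fun y => y ^ (m+1) * U y with hf
  have hfL : LocallyIntegrable f volume := by
    intro t
    refine ⟨Iio (t+1), Iio_mem_nhds (by linarith), ?_⟩
    rw [hf, integrableOn_indicator_iff measurableSet_Ioi, Ioi_inter_Iio]
    have h1 : IntegrableOn (fun x : E (m+2) => U ‖x‖) (Metric.ball 0 (t+1)) volume := by
      have := (huL.integrableOn_isCompact (isCompact_closedBall (0 : E (m+2)) (t+1))).mono_set
        Metric.ball_subset_closedBall
      refine this.congr (Eventually.of_forall fun x => ?_)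
      exact huU x
    rw [integrableOn_fun_norm_addHaar] at h1
    simpa using h1
  let ψ : ℕ → ContDiffBump (0:ℝ) := fun k =>
    ⟨1/((k:ℝ)+1), 2/((k:ℝ)+1), by positivity, by gcongr; norm_num⟩
  have hψ0 : Tendsto (fun k => (ψ k).rOut) atTop (𝓝 0) := by
    have := (tendsto_one_div_add_atTop_nhds_zero_nat (𝕜 := ℝ)).const_mul 2
    simpa [ψ, div_eq_mul_inv] using this
  have hconv := ContDiffBump.ae_convolution_tendsto_right_of_locallyIntegrable (K := 2)
    (μ := (volume : Measure ℝ)) hψ0 (Eventually.of_forall fun k => by simp [ψ]; field_simp; rfl) hfL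
  have hae : ∀ᵐ t : ℝ, 0 < t → |U t| ≤ C / ω * t ^ (-(((m:ℝ)-2)/2)) := by
    filter_upwards [hconv] with t ht htp
    have hR : Tendsto (fun k => C * (t - (ψ k).rOut) ^ (-(((m:ℝ)-2)/2)) *
        (t + (ψ k).rOut) ^ (m+1)) atTop
        (𝓝 (C * (t - 0) ^ (-(((m:ℝ)-2)/2)) * (t + 0) ^ (m+1))) := by
      refine ((((tendsto_const_nhds (x := t)).sub hψ0).rpow_const ?_).const_mul C).mul
        (((tendsto_const_nhds (x := t)).add hψ0).pow _)
      left; simp; exact htp.ne'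
    have hL := ht.abs.const_mul ω
    have hev : ∀ᶠ k in atTop, (ψ k).rOut < t := hψ0.eventually_lt_const htp
    have hle := le_of_tendsto_of_tendsto hL hR (by
      filter_upwards [hev] with k hk
      set ρ := (ψ k).rOut with hρ
      have hρ0 : 0 < ρ := (ψ k).rOut_pos
      set g : ℝ → ℝ := fun y => (ψ k).normed volume (t - y) with hg
      have hgc : Continuous g := by
        have : Continuous ((ψ k).normed volume) := (ψ k).continuous_normed
        fun_prop
      have hg0 : ∀ y, 0 ≤ g y := fun y => (ψ k).nonneg_normed _
      have hgz : ∀ y, ρ ≤ |t - y| → g y = 0 := by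
        intro y hy
        have : t - y ∉ Function.support ((ψ k).normed volume) := by
          rw [ContDiffBump.support_normed_eq]; simpa using hy
        simpa using this
      have hb := hbd u w hD hw g (t - ρ) (t + ρ) hgc hg0 (by linarith) (by linarith)
        (fun y hy => hgz y (by rw [le_abs]; left; linarith))
        (fun y hy => hgz y (by rw [le_abs]; right; linarith))
      have e1 : ∫ x : E (m+2), u x * g ‖x‖ = ω * ∫ y, g y * f y := by
        have h1 := integral_fun_norm_addHaar (volume : Measure (E (m+2))) (fun y => U y * g y)
        simp only [← huU] at h1
        rw [h1]
        simp only [finrank_euclideanSpace, Fintype.card_fin, nsmul_eq_mul, smul_eq_mul]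
        rw [hω, mul_assoc, ← integral_indicator measurableSet_Ioi]
        push_cast
        congr 2
        refine integral_congr_ae (Eventually.of_forall fun y => ?_)
        simp only [hf, indicator]
        split_ifs
        · ring
        · simp
      have e2 : ∫ τ in (t-ρ)..(t+ρ), g τ * τ ^ (m+1) ≤ (t+ρ)^(m+1) := by
        have hgi : Integrable g := (ψ k).integrable_normed.comp_sub_left t
        have hg1 : ∫ y, g y = 1 := by
          rw [hg, integral_sub_left_eq_self (fun y => (ψ k).normed volume y) volume t]
          exact (ψ k).integral_normed
        calc ∫ τ in (t-ρ)..(t+ρ), g τ * τ ^ (m+1) ≤ ∫ τ in (t-ρ)..(t+ρ), g τ * (t+ρ) ^ (m+1) := by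
              refine intervalIntegral.integral_mono_on (by linarith)
                (Continuous.intervalIntegrable (by fun_prop) _ _)
                (Continuous.intervalIntegrable (by fun_prop) _ _) fun y hy => ?_
              have := hg0 y
              have h2 : 0 ≤ y := by linarith [hy.1]
              gcongr
              exact hy.2
          _ = (∫ τ in (t-ρ)..(t+ρ), g τ) * (t+ρ)^(m+1) := by
              rw [intervalIntegral.integral_mul_const]
          _ ≤ 1 * (t+ρ)^(m+1) := by
              gcongr
              rw [intervalIntegral.integral_of_le (by linarith), ← hg1]
              exact setIntegral_le_integral hgi (Eventually.of_forall hg0)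
          _ = _ := one_mul _
      rw [convolution_lsmul_swap]
      simp only [smul_eq_mul]
      have h3 : 0 ≤ (t - ρ) ^ (-(((m:ℝ)-2)/2)) := Real.rpow_nonneg (by linarith) _
      calc ω * |∫ y, g y * f y| = |∫ x : E (m+2), u x * g ‖x‖| := by
            rw [e1, abs_mul, abs_of_pos hωpos]
        _ ≤ _ := hb
        _ ≤ _ := by gcongr)
    rw [hf, indicator_of_mem (by exact htp), abs_mul, abs_of_pos (by positivity), sub_zero,
      add_zero] at hle
    have htm : 0 < t ^ (m+1) := by positivity
    have h6 : ω * |U t| ≤ C * t ^ (-(((m:ℝ)-2)/2)) := by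
      refine le_of_mul_le_mul_right ?_ htm
      calc _ = ω * (t ^ (m+1) * |U t|) := by ring
        _ ≤ _ := hle
    rw [div_mul_eq_mul_div, le_div_iff₀ hωpos]
    linarith
  have := ae_norm (N := m+2) (by omega) hae
  filter_upwards [this] with x hx
  rw [huU x]; exact hx

theorem real_est {r v K u h A Λ α β q μ δ R : ℝ} (hr : 0 < r) (hrR : r ≤ R) (hv : 0 ≤ v)
    (hA : 0 ≤ A) (hΛ : 0 ≤ Λ) (hβ : 0 ≤ β) (hq1 : 1 < q) (hq2 : 2 * β < q)
    (hK : K ≤ Λ * (r ^ α * v ^ β)) (hu : |u| ≤ A * r ^ (-μ)) (hh : |h| ≤ A * r ^ (-μ))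
    (hγ : 0 ≤ α - μ * (q - 2 * β) - (1 - β) * δ) :
    K * |u| ^ (q - 1) * |h| ≤ Λ * A ^ (q - 2 * β) * R ^ (α - μ * (q - 2 * β) - (1 - β) * δ) *
      ((r ^ δ) ^ (1 - β) * (v * u ^ 2) ^ (β * (q - 1) / q) * (v * h ^ 2) ^ (β / q)) := by
  set a := β * (q - 1) / q with ha
  set b := β / q with hb
  have hq0 : 0 < q := by linarith
  have ha0 : 0 ≤ a := by have : 0 ≤ q - 1 := by linarith
                         positivity
  have hb0 : 0 ≤ b := by positivity
  have hab : a + b = β := by rw [ha, hb]; field_simp; ring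
  have ha2 : 0 ≤ q - 1 - 2 * a := by
    have : q - 1 - 2 * a = (q - 1) * (q - 2 * β) / q := by rw [ha]; field_simp
    rw [this]
    have h1 : 0 ≤ q - 1 := by linarith
    have h2 : 0 ≤ q - 2 * β := by linarith
    positivity
  have hb2 : 0 ≤ 1 - 2 * b := by
    have : 1 - 2 * b = (q - 2 * β) / q := by rw [hb]; field_simp
    rw [this]
    have h2 : 0 ≤ q - 2 * β := by linarith
    positivity
  have eu : |u| ^ (q - 1) = (u ^ 2) ^ a * |u| ^ (q - 1 - 2 * a) := by
    rw [← sq_abs u, ← Real.rpow_natCast, ← Real.rpow_mul (abs_nonneg u),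
      ← Real.rpow_add_of_nonneg (abs_nonneg u) (by push_cast; linarith) ha2]
    congr 1; push_cast; ring
  have eh : |h| = (h ^ 2) ^ b * |h| ^ (1 - 2 * b) := by
    rw [← sq_abs h, ← Real.rpow_natCast, ← Real.rpow_mul (abs_nonneg h),
      ← Real.rpow_add_of_nonneg (abs_nonneg h) (by push_cast; linarith) hb2]
    conv_lhs => rw [← Real.rpow_one |h|]
    congr 1; push_cast; ring
  have ev : v ^ β = v ^ a * v ^ b := by rw [← Real.rpow_add_of_nonneg hv ha0 hb0, hab]
  have hrμ : 0 < r ^ (-μ) := Real.rpow_pos_of_pos hr _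
  have bu : |u| ^ (q - 1 - 2 * a) ≤ (A * r ^ (-μ)) ^ (q - 1 - 2 * a) :=
    Real.rpow_le_rpow (abs_nonneg u) hu ha2
  have bh : |h| ^ (1 - 2 * b) ≤ (A * r ^ (-μ)) ^ (1 - 2 * b) :=
    Real.rpow_le_rpow (abs_nonneg h) hh hb2
  have hAr : 0 ≤ A * r ^ (-μ) := by positivity
  have eA : (A * r ^ (-μ)) ^ (q - 1 - 2 * a) * (A * r ^ (-μ)) ^ (1 - 2 * b) =
      A ^ (q - 2 * β) * r ^ (-μ * (q - 2 * β)) := by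
    rw [← Real.rpow_add_of_nonneg hAr ha2 hb2, Real.mul_rpow hA hrμ.le, ← Real.rpow_mul hr.le]
    have : q - 1 - 2 * a + (1 - 2 * b) = q - 2 * β := by rw [← hab]; ring
    rw [this]
  have er : r ^ α * r ^ (-μ * (q - 2 * β)) =
      r ^ (α - μ * (q - 2 * β) - (1 - β) * δ) * (r ^ δ) ^ (1 - β) := by
    rw [← Real.rpow_mul hr.le, ← Real.rpow_add hr, ← Real.rpow_add hr]
    congr 1; ring
  have hrR' : r ^ (α - μ * (q - 2 * β) - (1 - β) * δ) ≤ R ^ (α - μ * (q - 2 * β) - (1 - β) * δ) :=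
    Real.rpow_le_rpow hr.le hrR hγ
  have hrα : 0 < r ^ α := Real.rpow_pos_of_pos hr _
  calc K * |u| ^ (q - 1) * |h| ≤ Λ * (r ^ α * v ^ β) * |u| ^ (q - 1) * |h| := by gcongr
    _ = Λ * (r ^ α * (v ^ a * v ^ b)) * ((u ^ 2) ^ a * |u| ^ (q - 1 - 2 * a)) *
        ((h ^ 2) ^ b * |h| ^ (1 - 2 * b)) := by rw [ev, ← eu, ← eh]
    _ ≤ Λ * (r ^ α * (v ^ a * v ^ b)) * ((u ^ 2) ^ a * (A * r ^ (-μ)) ^ (q - 1 - 2 * a)) *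
        ((h ^ 2) ^ b * (A * r ^ (-μ)) ^ (1 - 2 * b)) := by gcongr
    _ = Λ * (v ^ a * v ^ b * (u ^ 2) ^ a * (h ^ 2) ^ b) * r ^ α *
        ((A * r ^ (-μ)) ^ (q - 1 - 2 * a) * (A * r ^ (-μ)) ^ (1 - 2 * b)) := by ring
    _ = Λ * (v ^ a * v ^ b * (u ^ 2) ^ a * (h ^ 2) ^ b) * A ^ (q - 2 * β) *
        (r ^ α * r ^ (-μ * (q - 2 * β))) := by rw [eA]; ring
    _ = Λ * (v ^ a * v ^ b * (u ^ 2) ^ a * (h ^ 2) ^ b) * A ^ (q - 2 * β) *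
        (r ^ (α - μ * (q - 2 * β) - (1 - β) * δ) * (r ^ δ) ^ (1 - β)) := by rw [er]
    _ ≤ Λ * (v ^ a * v ^ b * (u ^ 2) ^ a * (h ^ 2) ^ b) * A ^ (q - 2 * β) *
        (R ^ (α - μ * (q - 2 * β) - (1 - β) * δ) * (r ^ δ) ^ (1 - β)) := by gcongr
    _ = _ := by
        rw [Real.mul_rpow hv (sq_nonneg u), Real.mul_rpow hv (sq_nonneg h)]; ring

theorem norm_one {N : ℕ} {V : ℝ → ℝ≥0∞} {u w : E N → ℝ} (h : H2norm V u w = 1) :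
    eLpNorm w 2 volume ≤ 1 ∧ (∫⁻ x : E N, V ‖x‖ * ENNReal.ofReal ((u x) ^ 2)) ≤ 1 := by
  unfold H2norm at h
  set T := (∫⁻ x : E N, ENNReal.ofReal ((w x) ^ 2)) +
    ∫⁻ x : E N, V ‖x‖ * ENNReal.ofReal ((u x) ^ 2) with hT
  have h1 : T.toReal = 1 := by
    have := congrArg (fun z : ℝ => z ^ 2) h
    rw [← Real.sqrt_eq_rpow, Real.sq_sqrt ENNReal.toReal_nonneg] at this
    simpa using this
  have h2 : T = 1 := by
    rwa [ENNReal.toReal_eq_one_iff] at h1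
  refine ⟨?_, by rw [← h2, hT]; exact le_add_self⟩
  have h3 : (∫⁻ x : E N, ENNReal.ofReal ((w x) ^ 2)) ≤ 1 := by rw [← h2, hT]; exact le_self_add
  rw [eLpNorm_eq_lintegral_rpow_enorm_toReal (by simp) (by simp)]
  refine ENNReal.rpow_le_one ?_ (by positivity)
  refine le_trans (le_of_eq ?_) h3
  refine lintegral_congr fun x => ?_
  rw [← sq_abs, ENNReal.ofReal_pow (abs_nonneg _), ← Real.enorm_eq_ofReal_abs]
  simp

theorem stmt4_aux (m : ℕ) (hm : 3 ≤ m) (V : ℝ → ℝ≥0∞) (K : ℝ → ℝ) (s : ℝ)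
    (hV : HypV V) (hK : HypK K s) (R1 : ℝ) (hR1 : 0 < R1)
    (β₀ α₀ : ℝ) (hβ₀ : 0 ≤ β₀) (hβ₀' : β₀ ≤ 1)
    (hVfin : ∀ᵐ r ∂(volume.restrict (Set.Ioo (0:ℝ) R1)), V r < ⊤)
    (hess : essSup
      (fun r : ℝ => ENNReal.ofReal (K r) / (ENNReal.ofReal r ^ α₀ * V r ^ β₀))
      (volume.restrict (Set.Ioo (0:ℝ) R1)) < ⊤) (q : ℝ) (hq : max 1 (2*β₀) < q)
    (hq' : q < qStar (m+2) α₀ β₀) :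
      Tendsto (fun R => R0 (m+2) V K q R) (𝓝[>] (0:ℝ)) (𝓝 0) := by
  obtain ⟨A, hA, hpt⟩ := pointwise m hm
  set μ : ℝ := ((m:ℝ)-2)/2 with hμ
  have hm3 : (3:ℝ) ≤ m := by exact_mod_cast hm
  have hq1 : 1 < q := (le_max_left _ _).trans_lt hq
  have hq2 : 2 * β₀ < q := (le_max_right _ _).trans_lt hq
  set κ : ℝ := α₀ - 4 * β₀ + (m + 2) - μ * q with hκ
  have hκ0 : 0 < κ := by
    unfold qStar at hq'
    push_cast at hq'
    rw [lt_div_iff₀ (by linarith)] at hq'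
    rw [hκ, hμ]; linarith
  set δ : ℝ := -(m+2) + κ / 2 with hδ
  set γ : ℝ := α₀ - μ * (q - 2 * β₀) - (1 - β₀) * δ with hγ
  have hγ0 : 0 < γ := by
    have : γ = κ - (1 - β₀) * (κ / 2) := by rw [hγ, hδ, hκ, hμ]; ring
    rw [this]; nlinarith
  set Λ := essSup (fun r : ℝ => ENNReal.ofReal (K r) / (ENNReal.ofReal r ^ α₀ * V r ^ β₀))
      (volume.restrict (Set.Ioo (0:ℝ) R1)) with hΛ
  -- pointwise bound on K
  have hae1 : ∀ᵐ r : ℝ, 0 < r → (r < R1 → V r < ⊤ ∧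
      K r ≤ Λ.toReal * (r ^ α₀ * (V r).toReal ^ β₀)) := by
    have h1 := ENNReal.ae_le_essSup (μ := volume.restrict (Set.Ioo (0:ℝ) R1))
      (fun r : ℝ => ENNReal.ofReal (K r) / (ENNReal.ofReal r ^ α₀ * V r ^ β₀))
    rw [ae_restrict_iff' measurableSet_Ioo] at h1 hVfin
    filter_upwards [h1, hVfin] with r hr1 hr2 hr hrR
    have hVr := hr2 ⟨hr, hrR⟩
    refine ⟨hVr, ?_⟩
    have h2 := hr1 ⟨hr, hrR⟩
    have h3 : ENNReal.ofReal r ^ α₀ * V r ^ β₀ ≠ ⊤ := by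
      refine ENNReal.mul_ne_top ?_ (ENNReal.rpow_ne_top_of_nonneg hβ₀ hVr.ne)
      rw [ENNReal.ofReal_rpow_of_pos hr]; exact ENNReal.ofReal_ne_top
    rw [ENNReal.div_le_iff_le_mul (Or.inr hess.ne) (Or.inl h3)] at h2
    have h4 := ENNReal.toReal_mono (ENNReal.mul_ne_top hess.ne h3) h2
    rwa [ENNReal.toReal_ofReal (hK.1 r hr).le, ENNReal.toReal_mul, ENNReal.toReal_mul,
      ENNReal.ofReal_rpow_of_pos hr, ENNReal.toReal_ofReal (by positivity),
      ← ENNReal.toReal_rpow] at h4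
  have hae := ae_norm (N := m+2) (by omega) hae1
  have hne0 : ∀ᵐ x : E (m+2), x ≠ 0 := by
    rw [ae_iff]; simp
  -- the weight
  set D : ℝ≥0∞ := ∫⁻ x in Metric.ball (0 : E (m+2)) R1, ENNReal.ofReal (‖x‖ ^ δ) with hD
  have hDfin : D < ⊤ := by
    have hi : IntegrableOn (fun x : E (m+2) => ‖x‖ ^ δ) (Metric.ball 0 R1) volume := by
      rw [integrableOn_fun_norm_addHaar (volume : Measure (E (m+2))) (f := fun y : ℝ => y ^ δ)]
      have h1 : IntegrableOn (fun y : ℝ => y ^ (-1 + κ/2)) (Ioo 0 R1) volume :=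
        (intervalIntegral.integrableOn_Ioo_rpow_iff hR1).2 (by linarith)
      refine h1.congr_fun (fun y hy => ?_) measurableSet_Ioo
      simp only [finrank_euclideanSpace, Fintype.card_fin, smul_eq_mul]
      rw [← Real.rpow_natCast, ← Real.rpow_add hy.1]
      congr 1
      simp [hδ]; ring
    exact hi.lintegral_lt_top
  set a := β₀ * (q - 1) / q with ha
  set b := β₀ / q with hb
  have hq0 : 0 < q := by linarith
  have ha0 : 0 ≤ a := by
    have : 0 ≤ q - 1 := by linarith
    positivity
  have hb0 : 0 ≤ b := by positivity
  have hab : a + b = β₀ := by rw [ha, hb]; field_simp; ring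
  set c := Λ.toReal * A ^ (q - 2 * β₀) with hc
  have hc0 : 0 ≤ c := by positivity
  have hbound : ∀ R, R < R1 → 0 < R → R0 (m+2) V K q R ≤
      ENNReal.ofReal (c * R ^ γ) * D ^ (1 - β₀) := by
    intro R hR hR0
    refine iSup_le ?_
    rintro ⟨⟨⟨u, w⟩, ⟨h, z⟩⟩, hu, hh, hun, hhn⟩
    simp only at hu hh hun hhn ⊢
    obtain ⟨hw, hVu⟩ := norm_one hun
    obtain ⟨hz, hVh⟩ := norm_one hhn
    have hpu := hpt u w hu.1.1 hu.2 hw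
    have hph := hpt h z hh.1.1 hh.2 hz
    set f : Fin 3 → E (m+2) → ℝ≥0∞ := ![fun x => ENNReal.ofReal (‖x‖ ^ δ),
      fun x => V ‖x‖ * ENNReal.ofReal (u x ^ 2), fun x => V ‖x‖ * ENNReal.ofReal (h x ^ 2)] with hf
    set p : Fin 3 → ℝ := ![1 - β₀, a, b] with hp
    have hVm : Measurable fun x : E (m+2) => V ‖x‖ := hV.1.comp measurable_norm
    have hfm : ∀ i ∈ (Finset.univ : Finset (Fin 3)),
        AEMeasurable (f i) (volume.restrict (Metric.ball (0 : E (m+2)) R)) := by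
      intro i _
      have hum : AEMeasurable u volume := hu.1.1.1.1.aemeasurable
      have hhm : AEMeasurable h volume := hh.1.1.1.1.aemeasurable
      fin_cases i
      · exact (Measurable.ennreal_ofReal (measurable_norm.pow_const δ)).aemeasurable
      · exact (hVm.aemeasurable.mul (hum.pow_const 2).ennreal_ofReal).restrict
      · exact (hVm.aemeasurable.mul (hhm.pow_const 2).ennreal_ofReal).restrict
    have hH := ENNReal.lintegral_prod_norm_pow_le (Finset.univ : Finset (Fin 3)) hfm (p := p)
      (by simp [Fin.sum_univ_three, hp]; linarith)
      (by intro i _; fin_cases i <;> simp [hp] <;> linarith)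
    simp only [Fin.prod_univ_three, hf, hp, Matrix.cons_val_zero, Matrix.cons_val_one,
      Matrix.cons_val] at hH
    calc ∫⁻ x in Metric.ball (0 : E (m+2)) R, ENNReal.ofReal (K ‖x‖ * |u x| ^ (q - 1) * |h x|)
        ≤ ∫⁻ x in Metric.ball (0 : E (m+2)) R, ENNReal.ofReal (c * R ^ γ) *
          (ENNReal.ofReal (‖x‖ ^ δ) ^ (1 - β₀) * (V ‖x‖ * ENNReal.ofReal (u x ^ 2)) ^ a *
            (V ‖x‖ * ENNReal.ofReal (h x ^ 2)) ^ b) := by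
          refine lintegral_mono_ae ?_
          rw [ae_restrict_iff' measurableSet_ball]
          filter_upwards [hae, hne0, hpu, hph] with x hx hx0 hux hhx hxR
          have hxR' : ‖x‖ < R := by simpa using hxR
          have hxp := norm_pos_iff.2 hx0
          obtain ⟨hVx, hKx⟩ := hx (hxR'.trans hR)
          have hest := real_est (δ := δ) hxp hxR'.le (ENNReal.toReal_nonneg (a := V ‖x‖)) hA
            (ENNReal.toReal_nonneg (a := Λ)) hβ₀ hq1 hq2 hKx hux hhx hγ0.le
          refine (ENNReal.ofReal_le_ofReal hest).trans (le_of_eq ?_)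
          have hVe : ∀ y : ℝ, V ‖x‖ * ENNReal.ofReal (y ^ 2) =
              ENNReal.ofReal ((V ‖x‖).toReal * y ^ 2) := by
            intro y
            rw [ENNReal.ofReal_mul ENNReal.toReal_nonneg, ENNReal.ofReal_toReal hVx.ne]
          rw [hVe, hVe, ENNReal.ofReal_rpow_of_nonneg (by positivity) (by linarith),
            ENNReal.ofReal_rpow_of_nonneg (by positivity) ha0,
            ENNReal.ofReal_rpow_of_nonneg (by positivity) hb0,
            ← ENNReal.ofReal_mul (by positivity), ← ENNReal.ofReal_mul (by positivity),
            ← ENNReal.ofReal_mul (by positivity)]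
      _ = ENNReal.ofReal (c * R ^ γ) * ∫⁻ x in Metric.ball (0 : E (m+2)) R, 
          (ENNReal.ofReal (‖x‖ ^ δ) ^ (1 - β₀) * (V ‖x‖ * ENNReal.ofReal (u x ^ 2)) ^ a *
            (V ‖x‖ * ENNReal.ofReal (h x ^ 2)) ^ b) :=
          lintegral_const_mul' _ _ ENNReal.ofReal_ne_top
      _ ≤ ENNReal.ofReal (c * R ^ γ) * (D ^ (1 - β₀) * 1 * 1) := by
          gcongr
          refine hH.trans ?_
          gcongr
          · exact lintegral_mono_set (Metric.ball_subset_ball hR.le)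
          · exact ENNReal.rpow_le_one ((setLIntegral_le_lintegral _ _).trans hVu) ha0
          · exact ENNReal.rpow_le_one ((setLIntegral_le_lintegral _ _).trans hVh) hb0
      _ = _ := by simp
  have hlim : Tendsto (fun R : ℝ => ENNReal.ofReal (c * R ^ γ) * D ^ (1 - β₀)) (𝓝[>] 0) (𝓝 0) := by
    have h1 : Tendsto (fun R : ℝ => c * R ^ γ) (𝓝[>] 0) (𝓝 0) := by
      have := ((Real.continuousAt_rpow_const 0 γ (Or.inr hγ0.le)).tendsto.const_mul c)
      rw [Real.zero_rpow hγ0.ne', mul_zero] at this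
      exact this.mono_left nhdsWithin_le_nhds
    have h2 := ENNReal.tendsto_ofReal h1
    rw [ENNReal.ofReal_zero] at h2
    have h3 := ENNReal.Tendsto.mul_const (b := D ^ (1 - β₀)) h2
      (Or.inr (ENNReal.rpow_ne_top_of_nonneg (by linarith) hDfin.ne))
    simpa using h3
  refine tendsto_of_tendsto_of_tendsto_of_le_of_le' tendsto_const_nhds hlim
    (Eventually.of_forall fun _ => zero_le) ?_
  filter_upwards [Ioo_mem_nhdsGT hR1] with R hR
  exact hbound R hR.2 hR.1

/-- Theorem 2.2: if `K(r)/(r^{α₀}V(r)^{β₀})` is essentially bounded near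
the origin with `0 ≤ β₀ ≤ 1`, `α₀ > α*(β₀)`, then `R₀(q₁,R) → 0` as `R → 0⁺` for all
`q₁` with `max{1,2β₀} < q₁ < q*(α₀,β₀)`. -/
theorem stmt4 (N : ℕ) (hN : 5 ≤ N) (V : ℝ → ℝ≥0∞) (K : ℝ → ℝ) (s : ℝ)
    (hV : HypV V) (hK : HypK K s) (R1 : ℝ) (hR1 : 0 < R1)
    (β₀ α₀ : ℝ) (hβ₀ : 0 ≤ β₀) (hβ₀' : β₀ ≤ 1) (hα₀ : alphaStar N β₀ < α₀)
    (hVfin : ∀ᵐ r ∂(volume.restrict (Set.Ioo (0:ℝ) R1)), V r < ⊤)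
    (hess : essSup
      (fun r : ℝ => ENNReal.ofReal (K r) / (ENNReal.ofReal r ^ α₀ * V r ^ β₀))
      (volume.restrict (Set.Ioo (0:ℝ) R1)) < ⊤) :
    ∀ q1 : ℝ, max 1 (2*β₀) < q1 → q1 < qStar N α₀ β₀ →
      Tendsto (fun R => R0 N V K q1 R) (𝓝[>] (0:ℝ)) (𝓝 0) := by
  intro q1 h1 h2
  obtain ⟨m, rfl⟩ : ∃ m, N = m + 2 := ⟨N - 2, by omega⟩
  exact stmt4_aux m (by omega) V K s hV hK R1 hR1 β₀ α₀ hβ₀ hβ₀' hVfin hess q1 h1 h2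

end
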